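/- Let n ≥ 2 and let b_1,…,b_{n−1} be positive integers, and set a_k := b_1 + b_2 + ⋯ + b_k for 1 ≤ k ≤ n−1. Then Σ_{M ∈ T(b_1,…,b_{n−1})} ∏_{1≤i≤j≤n−1} wt(m_{ij}) = q^{−Σ_{k=1}^{n−1} a_k} · (q−1)^{2(n−1)} · [b_1]_{q^n} · ∏_{j=1}^{n−2} [(j+1)a_{n−j} − j·a_{n−j−1}]_q. (This is Conjecture 7.2 of Armstrong–Garsia–Haglund–Rhoades–Sagan / Conjecture 5.10 of Galashin–Lam–Williams, in terms of Tesler matrices.) -/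

import Mathlib

noncomputable def q : RatFunc ℚ := RatFunc.X

noncomputable def qint (b : RatFunc ℚ) (k : ℤ) : RatFunc ℚ := (b ^ k - 1) / (b - 1)

noncomputable def wt (r : ℕ) : RatFunc ℚ :=
  if r = 0 then 1
  else q ^ (-(r : ℤ)) * (q - 1) ^ 2 * (q ^ (2 * r) - 1) / (q ^ 2 - 1)

/-- Index set for the entries of an `N × N` upper-triangular matrix (1-based). -/
def upairs (N : ℕ) : Finset (ℕ × ℕ) :=
  (Finset.Icc 1 N ×ˢ Finset.Icc 1 N).filter fun p => p.1 ≤ p.2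

/-- `M` is a Tesler matrix of size `N × N` with hook sums `b`. -/
def IsTesler (N : ℕ) (b : ℕ → ℤ) (M : ℕ × ℕ → ℕ) : Prop :=
  (∀ p ∉ upairs N, M p = 0) ∧
    ∀ i ∈ Finset.Icc 1 N,
      (∑ j ∈ Finset.Icc i N, (M (i, j) : ℤ)) - (∑ j ∈ Finset.Icc 1 (i - 1), (M (j, i) : ℤ)) = b i


namespace TeslerAux

open PowerSeries

variable {K : Type*} [Field K]

/-- `1 - u X`. -/
noncomputable def LL (u : K) : PowerSeries K := 1 - C u * X

/-- Two-term geometric series. -/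
noncomputable def GG (al u v : K) : PowerSeries K :=
  1 + C al * (PowerSeries.mk (fun n => u ^ n) - PowerSeries.mk (fun n => v ^ n))

lemma LL_ne (u : K) : LL u ≠ 0 := by
  intro h
  have := congrArg (coeff 0) h
  simp [LL] at this

lemma mk_mul_LL (u : K) : PowerSeries.mk (fun n => u ^ n) * LL u = 1 := by
  ext n
  rw [LL, mul_sub, mul_one, mul_comm (C u), ← mul_assoc]
  cases n with
  | zero => simp
  | succ n => simp [coeff_succ_mul_X, pow_succ]

lemma LL_mul (u v : K) : LL u * LL v = 1 - C (u + v) * X + C (u * v) * X ^ 2 := by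
  simp only [LL, map_add, map_mul]; ring

lemma GG_mul (al u v : K) : GG al u v * (LL u * LL v) = LL u * LL v + C (al * (u - v)) * X := by
  have hu := mk_mul_LL u
  have hv := mk_mul_LL v
  have : GG al u v * (LL u * LL v) = LL u * LL v + C al * (LL v - LL u) := by
    rw [GG]
    linear_combination C al * LL v * hu - C al * LL u * hv
  rw [this]
  simp only [LL, map_mul, map_sub]; ring

lemma GG_tele (q al u v : K) (hq : q ≠ 0) (h : al * (u - v) = (q - 1) * (u / q - v)) :
    GG al u v * (LL u * LL v) = LL (u / q) * LL (v * q) := by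
  rw [GG_mul, LL_mul, LL_mul, h]
  have h1 : u / q * (v * q) = u * v := by field_simp
  have h2 : (u / q + v * q) = (u + v) - (q - 1) * (u / q - v) := by field_simp; ring
  rw [h1, h2]
  simp only [map_sub]; ring

lemma rescale_LL (a u : K) : rescale a (LL u) = LL (a * u) := by
  ext n
  simp only [LL, coeff_rescale, map_sub, coeff_C_mul, coeff_one, coeff_X]
  rcases n with _ | _ | n <;> simp

/-- The weight generating function rescaled by `q^c`. -/
noncomputable def V (q : K) (c : ℤ) : PowerSeries K :=
  rescale (q ^ c) (GG ((q - 1) ^ 2 / (q ^ 2 - 1)) q q⁻¹)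

lemma V_mul (q : K) (hq : q ≠ 0) (h2 : q ^ 2 ≠ 1) (c : ℤ) :
    V q c * (LL (q ^ (c + 1)) * LL (q ^ (c - 1))) = LL (q ^ c) * LL (q ^ c) := by
  have := GG_tele q ((q - 1) ^ 2 / (q ^ 2 - 1)) q q⁻¹ hq (by
    have : q ^ 2 - 1 ≠ 0 := sub_ne_zero.2 h2
    field_simp)
  have := congrArg (rescale (q ^ c)) this
  simp only [map_mul, rescale_LL] at this
  rw [div_self hq, inv_mul_cancel₀ hq, mul_one] at this
  rw [V, zpow_add_one₀ hq, zpow_sub_one₀ hq, this]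

/-- Exponent attached to index `k` for the subset `D`. -/
def cc (N : ℕ) (D : Finset ℕ) (k : ℕ) : ℤ :=
  (if k ∈ D then 0 else (N : ℤ) + 1 - k) - ((Finset.Icc k N).filter (· ∈ D)).card

/-- number of elements of `D` in `[s,N]` -/
def dd (N : ℕ) (D : Finset ℕ) (s : ℕ) : ℤ := ((Finset.Icc s N).filter (· ∈ D)).card

lemma dd_step (N : ℕ) (D : Finset ℕ) (s : ℕ) (h : s ≤ N) :
    dd N D s = dd N D (s + 1) + if s ∈ D then 1 else 0 := by
  unfold dd
  rw [← Finset.insert_Icc_add_one_left_eq_Icc h, Finset.filter_insert]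
  split_ifs
  · rw [Finset.card_insert_of_notMem (by simp)]; simp
  · simp

lemma prod_V (q : K) (hq : q ≠ 0) (h2 : q ^ 2 ≠ 1) (N : ℕ) (D : Finset ℕ) (r : ℕ) :
    ∀ s, s + r = N + 1 →
    (V q 0 * ∏ k ∈ Finset.Icc s N, V q (cc N D k)) *
      (LL (q ^ (r - dd N D s + 1)) * LL (q ^ (- dd N D s - 1))) =
      LL (q ^ (r - dd N D s)) * LL (q ^ (- dd N D s)) := by
  induction r with
  | zero =>
    intro s hs
    have : Finset.Icc s N = ∅ := Finset.Icc_eq_empty (by omega)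
    have h := V_mul q hq h2 0
    simpa [dd, this] using h
  | succ r ih =>
    intro s hs
    have ih := ih (s + 1) (by omega)
    have hsN : s ≤ N := by omega
    rw [← Finset.insert_Icc_add_one_left_eq_Icc hsN, Finset.prod_insert (by simp)]
    have hd := dd_step N D s hsN
    have hc : cc N D s = (if s ∈ D then 0 else (N : ℤ) + 1 - s) - dd N D s := rfl
    set d := dd N D (s + 1)
    have hr : (N : ℤ) + 1 - s = r + 1 := by omega
    rw [hr] at hc
    split_ifs at hd hc with hD
    · rw [hd] at hc ⊢
      have hV := V_mul q hq h2 (cc N D s)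
      rw [hc] at hV ⊢
      push_cast
      rw [show (0 - (d + 1) + 1 : ℤ) = - d by ring, show (0 - (d + 1) - 1 : ℤ) = - d - 2 by ring,
        show (0 - (d + 1) : ℤ) = - d - 1 by ring] at hV
      rw [show (r + 1 - (d + 1) + 1 : ℤ) = r - d + 1 by ring,
        show (-(d + 1) - 1 : ℤ) = - d - 2 by ring, show (0 - (d + 1) : ℤ) = - d - 1 by ring,
        show (r + 1 - (d + 1) : ℤ) = r - d by ring, show (-(d + 1) : ℤ) = - d - 1 by ring]
      apply mul_left_cancel₀ (mul_ne_zero (LL_ne (q ^ (-d))) (LL_ne (q ^ (-d - 1))))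
      linear_combination (V q (-d - 1) * LL (q ^ (-d)) * LL (q ^ (-d - 2))) * ih
        + LL (q ^ (r - d : ℤ)) * LL (q ^ (-d)) * hV
    · rw [add_zero] at hd
      rw [hd] at hc ⊢
      have hV := V_mul q hq h2 (cc N D s)
      rw [hc] at hV ⊢
      push_cast
      rw [show (r + 1 - d + 1 : ℤ) = r - d + 2 by ring, show (r + 1 - d - 1 : ℤ) = r - d by ring,
        show (r + 1 - d : ℤ) = r - d + 1 by ring] at hV
      rw [show (r + 1 - d + 1 : ℤ) = r - d + 2 by ring, 
        show (r + 1 - d : ℤ) = r - d + 1 by ring]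
      apply mul_left_cancel₀ (mul_ne_zero (LL_ne (q ^ (r - d : ℤ))) (LL_ne (q ^ (r - d + 1 : ℤ))))
      linear_combination (V q (r - d + 1) * LL (q ^ (r - d : ℤ)) * LL (q ^ (r - d + 2 : ℤ))) * ih
        + LL (q ^ (r - d : ℤ)) * LL (q ^ (-d)) * hV

lemma coeff_prod_V (q : K) (hq : q ≠ 0) (h2 : ∀ k : ℕ, k ≠ 0 → q ^ k ≠ 1) (N : ℕ) (D : Finset ℕ)
    (r s : ℕ) (hs : s + r = N + 1) (B : ℕ) (hB : B ≠ 0) :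
    coeff B (V q 0 * ∏ k ∈ Finset.Icc s N, V q (cc N D k)) =
      (q - 1) * (q ^ (r + 1) - 1) / (q ^ (r + 2) - 1) *
        (q ^ ((r - dd N D s + 1) * B) - q ^ ((- dd N D s - 1) * B)) := by
  set d := dd N D s with hd
  have hne := sub_ne_zero.2 (h2 (r + 2) (by omega))
  have h := prod_V q hq (h2 2 (by omega)) N D r s hs
  have hG := GG_tele q ((q - 1) * (q ^ (r + 1) - 1) / (q ^ (r + 2) - 1)) (q ^ (r - d + 1 : ℤ))
    (q ^ (- d - 1)) hq (by
      have e1 : q ^ (r - d + 1 : ℤ) = q ^ (r + 2) * q ^ (-d - 1) := by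
        rw [← zpow_natCast, ← zpow_add₀ hq]; congr 1; push_cast; ring
      rw [e1]
      field_simp
      ring)
  rw [show q ^ (r - d + 1 : ℤ) / q = q ^ (r - d : ℤ) by rw [zpow_add_one₀ hq]; field_simp,
    show q ^ (- d - 1 : ℤ) * q = q ^ (- d : ℤ) by rw [← zpow_add_one₀ hq]; congr 1; ring] at hG
  rw [← hd] at h
  rw [mul_right_cancel₀ (mul_ne_zero (LL_ne _) (LL_ne _)) (h.trans hG.symm)]
  simp [GG, coeff_one, hB, zpow_mul]


lemma zpow_sum_aux (q : K) (hq : q ≠ 0) {ι : Type*} (S : Finset ι) (f : ι → ℤ) :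
    ∏ i ∈ S, q ^ f i = q ^ ∑ i ∈ S, f i := by
  classical
  induction S using Finset.induction_on with
  | empty => simp
  | insert a S ha ih => rw [Finset.prod_insert ha, Finset.sum_insert ha, zpow_add₀ hq, ih]

lemma expo (N s : ℕ) (D : Finset ℕ) (hD : D ⊆ Finset.Icc s N) (b : ℕ → ℤ) (x : ℤ) :
    ∑ k ∈ Finset.Icc s N \ D, ((N : ℤ) + 1 - k) * b k + ∑ k ∈ D, (x - ∑ l ∈ Finset.Icc s k, b l)
      = x * D.card + ∑ k ∈ Finset.Icc s N, cc N D k * b k := by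
  have h1 : ∑ k ∈ D, ∑ l ∈ Finset.Icc s k, b l =
      ∑ l ∈ Finset.Icc s N, ∑ k ∈ (Finset.Icc l N).filter (· ∈ D), b l := by
    apply Finset.sum_comm'
    intro k l
    simp only [Finset.mem_Icc, Finset.mem_filter]
    constructor
    · rintro ⟨h, h'⟩
      have := Finset.mem_Icc.1 (hD h)
      exact ⟨⟨⟨h'.2, this.2⟩, h⟩, h'.1, by omega⟩
    · rintro ⟨⟨h, h'⟩, h''⟩
      exact ⟨h', h''.1, h.1⟩
  have h2 : ∑ k ∈ Finset.Icc s N \ D, ((N : ℤ) + 1 - k) * b k =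
      ∑ k ∈ Finset.Icc s N, (if k ∈ D then 0 else (N : ℤ) + 1 - k) * b k := by
    rw [← Finset.filter_notMem_eq_sdiff, Finset.sum_filter]
    apply Finset.sum_congr rfl
    intro k _
    split_ifs <;> simp_all
  rw [Finset.sum_sub_distrib, h1, h2]
  simp only [cc, sub_mul, Finset.sum_sub_distrib, Finset.sum_const, nsmul_eq_mul]
  ring

lemma prod_expand (q : K) (hq : q ≠ 0) (N s : ℕ) (b : ℕ → ℤ) (x : ℤ) :
    ∏ k ∈ Finset.Icc s N, (q ^ (((N : ℤ) + 1 - k) * b k) - q ^ (x - ∑ l ∈ Finset.Icc s k, b l)) =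
    ∑ D ∈ (Finset.Icc s N).powerset, (-1) ^ D.card * q ^ (x * D.card) *
      ∏ k ∈ Finset.Icc s N, q ^ (cc N D k * b k) := by
  rw [Finset.prod_sub]
  apply Finset.sum_congr rfl
  intro D hD
  rw [zpow_sum_aux q hq, zpow_sum_aux q hq, zpow_sum_aux q hq, mul_assoc, mul_assoc,
    ← zpow_add₀ hq, ← zpow_add₀ hq, expo N s D (Finset.mem_powerset.1 hD)]

/-- The product formula. -/
noncomputable def PP (q : K) (N s : ℕ) (b : ℕ → ℤ) : K :=
  ∏ k ∈ Finset.Icc s N, (q ^ (((N : ℤ) + 1 - k) * b k) - q ^ (- ∑ l ∈ Finset.Icc s k, b l))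

/-- general weight -/
noncomputable def WW (q : K) (n : ℕ) : K := coeff n (GG ((q - 1) ^ 2 / (q ^ 2 - 1)) q q⁻¹)

lemma coeff_V (q : K) (c : ℤ) (n : ℕ) : coeff n (V q c) = WW q n * q ^ (c * n) := by
  rw [V, coeff_rescale, WW, zpow_mul, zpow_natCast, mul_comm]

lemma PP_step (q : K) (hq : q ≠ 0) (h2 : ∀ k : ℕ, k ≠ 0 → q ^ k ≠ 1) (N s r : ℕ)
    (hs : s + r = N) (b : ℕ → ℤ) (hb : 0 < b s) :
    ∑ m ∈ (Finset.Icc s N).finsuppAntidiag (b s).toNat,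
      (∏ k ∈ Finset.Icc s N, WW q (m k)) * PP q N (s + 1) (fun i => b i + (m i : ℤ)) =
    (q - 1) * (q ^ (r + 1) - 1) / (q ^ (r + 2) - 1) * PP q N s b := by
  have hsN : s ≤ N := by omega
  have key : ∀ D ∈ (Finset.Icc (s + 1) N).powerset,
      ∑ m ∈ (Finset.Icc s N).finsuppAntidiag (b s).toNat,
        (∏ k ∈ Finset.Icc s N, WW q (m k)) * ∏ k ∈ Finset.Icc (s + 1) N, q ^ (cc N D k * m k) =
      (q - 1) * (q ^ (r + 1) - 1) / (q ^ (r + 2) - 1) *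
        (q ^ ((r + 1) * b s) - q ^ (- b s)) * q ^ (- b s * D.card) := by
    intro D hD
    have hc := coeff_prod_V q hq h2 N D r (s + 1) (by omega) (b s).toNat (by omega)
    have hdd : dd N D (s + 1) = D.card := by
      unfold dd
      congr 2
      rw [Finset.filter_mem_eq_inter, Finset.inter_eq_right]
      exact Finset.mem_powerset.1 hD
    rw [hdd, Int.toNat_of_nonneg hb.le] at hc
    have hP : V q 0 * ∏ k ∈ Finset.Icc (s + 1) N, V q (cc N D k) =
        ∏ k ∈ Finset.Icc s N, V q (if k = s then 0 else cc N D k) := by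
      rw [← Finset.insert_Icc_add_one_left_eq_Icc hsN, Finset.prod_insert (by simp), if_pos rfl]
      congr 1
      apply Finset.prod_congr rfl
      intro k hk
      rw [if_neg]
      have := Finset.mem_Icc.1 hk
      omega
    rw [hP, coeff_prod] at hc
    rw [mul_assoc, sub_mul (q ^ ((r + 1) * b s)), ← zpow_add₀ hq, ← zpow_add₀ hq]
    rw [show (r + 1) * b s + - b s * D.card = (r - D.card + 1) * b s by ring,
      show - b s + - b s * D.card = (- D.card - 1) * b s by ring, ← hc]
    apply Finset.sum_congr rfl
    intro m _
    simp only [coeff_V]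
    rw [Finset.prod_mul_distrib]
    congr 1
    rw [← Finset.insert_Icc_add_one_left_eq_Icc hsN, Finset.prod_insert (by simp), if_pos rfl]
    simp only [zero_mul, zpow_zero, one_mul]
    apply Finset.prod_congr rfl
    intro k hk
    rw [if_neg]
    have := Finset.mem_Icc.1 hk
    omega
  have hL : ∀ m : ℕ →₀ ℕ, PP q N (s + 1) (fun i => b i + (m i : ℤ)) =
      ∑ D ∈ (Finset.Icc (s + 1) N).powerset, (-1) ^ D.card *
        (∏ k ∈ Finset.Icc (s + 1) N, q ^ (cc N D k * b k)) *
        ∏ k ∈ Finset.Icc (s + 1) N, q ^ (cc N D k * m k) := by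
    intro m
    have := prod_expand q hq N (s + 1) (fun i => b i + (m i : ℤ)) 0
    simp only [zero_sub, zero_mul, zpow_zero, mul_one] at this
    rw [PP, this]
    apply Finset.sum_congr rfl
    intro D _
    rw [mul_assoc, ← Finset.prod_mul_distrib]
    congr 1
    apply Finset.prod_congr rfl
    intro k _
    rw [← zpow_add₀ hq, mul_add]
  have hR : PP q N s b = (q ^ ((r + 1) * b s) - q ^ (- b s)) *
      ∑ D ∈ (Finset.Icc (s + 1) N).powerset, (-1) ^ D.card * q ^ (- b s * D.card) *
        ∏ k ∈ Finset.Icc (s + 1) N, q ^ (cc N D k * b k) := by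
    rw [← prod_expand q hq N (s + 1) b (- b s), PP]
    conv_lhs => rw [← Finset.insert_Icc_add_one_left_eq_Icc hsN, Finset.prod_insert (by simp)]
    congr 1
    · rw [Finset.Icc_self, Finset.sum_singleton]
      congr 3
      omega
    · apply Finset.prod_congr rfl
      intro k hk
      have := Finset.mem_Icc.1 hk
      congr 2
      rw [← Finset.insert_Icc_add_one_left_eq_Icc (show s ≤ k by omega),
        Finset.sum_insert (by simp)]
      ring
  simp only [hL, Finset.mul_sum]
  rw [Finset.sum_comm, hR, Finset.mul_sum, Finset.mul_sum]
  apply Finset.sum_congr rfl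
  intro D hD
  have := key D hD
  calc _ = (-1) ^ D.card * (∏ k ∈ Finset.Icc (s + 1) N, q ^ (cc N D k * b k)) *
      ∑ m ∈ (Finset.Icc s N).finsuppAntidiag (b s).toNat,
        (∏ k ∈ Finset.Icc s N, WW q (m k)) *
          ∏ k ∈ Finset.Icc (s + 1) N, q ^ (cc N D k * m k) := by
        rw [Finset.mul_sum]
        apply Finset.sum_congr rfl
        intro m _
        ring
    _ = _ := by rw [this]; ring

/-- index pairs -/
def pr (N s : ℕ) : Finset (ℕ × ℕ) :=
  (Finset.Icc s N ×ˢ Finset.Icc s N).filter fun p => p.1 ≤ p.2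

/-- partial Tesler matrices -/
def TS (N s : ℕ) (b : ℕ → ℤ) : Set (ℕ × ℕ → ℕ) :=
  {M | (∀ p ∉ pr N s, M p = 0) ∧
    ∀ i ∈ Finset.Icc s N,
      (∑ j ∈ Finset.Icc i N, (M (i, j) : ℤ)) - (∑ j ∈ Finset.Icc s (i - 1), (M (j, i) : ℤ)) = b i}

/-- insert a row -/
def ins (s : ℕ) (m : ℕ →₀ ℕ) (M : ℕ × ℕ → ℕ) : ℕ × ℕ → ℕ :=
  fun p => if p.1 = s then m p.2 else M p

lemma TS_eq (N s : ℕ) (hs : 1 ≤ s) (hsN : s ≤ N) (b : ℕ → ℤ) (hb : 0 < b s) :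
    TS N s b = ⋃ m ∈ ((Finset.Icc s N).finsuppAntidiag (b s).toNat : Set (ℕ →₀ ℕ)),
      ins s m '' TS N (s + 1) (fun i => b i + (m i : ℤ)) := by
  ext M
  simp only [Set.mem_iUnion, Set.mem_image, exists_prop, Finset.mem_coe,
    Finset.mem_finsuppAntidiag]
  constructor
  · rintro ⟨h0, h1⟩
    have hout : ∀ k, k ∉ Finset.Icc s N → M (s, k) = 0 := by
      intro k hk
      apply h0
      simp only [pr, Finset.mem_filter, Finset.mem_product]
      tauto
    refine ⟨Finsupp.onFinset (Finset.Icc s N) (fun k => M (s, k)) ?_, ⟨?_, ?_⟩,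
      fun p => if p.1 = s then 0 else M p, ⟨?_, ?_⟩, ?_⟩
    · intro k hk
      by_contra h
      exact hk (hout k h)
    · have := h1 s (by simp [hsN])
      rw [Finset.Icc_eq_empty (a := s) (b := s - 1) (by omega)] at this
      zify
      rw [Int.toNat_of_nonneg hb.le, ← this]
      simp
    · exact Finsupp.support_onFinset_subset
    · intro p hp
      beta_reduce
      split_ifs with h
      · rfl
      · apply h0
        simp only [pr, Finset.mem_filter, Finset.mem_product, Finset.mem_Icc] at hp ⊢
        omega
    · intro i hi
      simp only [Finset.mem_Icc] at hi
      have := h1 i (by simp only [Finset.mem_Icc]; omega)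
      rw [← Finset.insert_Icc_add_one_left_eq_Icc (show s ≤ i - 1 by omega),
        Finset.sum_insert (by simp)] at this
      simp only [Finsupp.onFinset_apply]
      rw [← this]
      have e1 : ∀ j ∈ Finset.Icc i N, ((if (i, j).1 = s then 0 else M (i, j) : ℕ) : ℤ) = M (i, j) := by
        intro j _
        rw [if_neg (show i ≠ s by omega)]
      have e2 : ∀ j ∈ Finset.Icc (s + 1) (i - 1),
          ((if (j, i).1 = s then 0 else M (j, i) : ℕ) : ℤ) = M (j, i) := by
        intro j hj
        simp only [Finset.mem_Icc] at hj
        rw [if_neg (show j ≠ s by omega)]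
      rw [Finset.sum_congr rfl e1, Finset.sum_congr rfl e2]
      ring
    · funext p
      rcases p with ⟨i, j⟩
      simp only [ins, Finsupp.onFinset_apply]
      split_ifs with h
      · rw [h]
      · rfl
  · rintro ⟨m, ⟨hm, hsup⟩, M', ⟨h0, h1⟩, rfl⟩
    refine ⟨?_, ?_⟩
    · intro p hp
      simp only [pr, Finset.mem_filter, Finset.mem_product, Finset.mem_Icc] at hp
      unfold ins
      split_ifs with h
      · by_contra hne
        have := Finset.mem_Icc.1 (hsup (Finsupp.mem_support_iff.2 hne))
        omega
      · apply h0
        simp only [pr, Finset.mem_filter, Finset.mem_product, Finset.mem_Icc]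
        omega
    · intro i hi
      rw [Finset.mem_Icc] at hi
      by_cases his : i = s
      · subst his
        rw [Finset.Icc_eq_empty (a := i) (b := i - 1) (by omega)]
        zify at hm
        rw [Int.toNat_of_nonneg hb.le] at hm
        simp [ins, hm]
      · have := h1 i (by rw [Finset.mem_Icc]; omega)
        rw [← Finset.insert_Icc_add_one_left_eq_Icc (show s ≤ i - 1 by omega),
          Finset.sum_insert (by simp)]
        have e1 : ∀ j ∈ Finset.Icc i N, (ins s m M' (i, j) : ℤ) = M' (i, j) := by
          intro j _
          simp [ins, his]
        have e2 : ∀ j ∈ Finset.Icc (s + 1) (i - 1), (ins s m M' (j, i) : ℤ) = M' (j, i) := by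
          intro j hj
          simp only [Finset.mem_Icc] at hj
          simp [ins, show j ≠ s by omega]
        rw [Finset.sum_congr rfl e1, Finset.sum_congr rfl e2]
        have e3 : (ins s m M' (s, i) : ℤ) = m i := by simp [ins]
        rw [e3]
        linarith

lemma TS_base (N : ℕ) (b : ℕ → ℤ) : TS N (N + 1) b = {0} := by
  ext M
  simp only [TS, pr, Set.mem_setOf_eq, Set.mem_singleton_iff]
  rw [Finset.Icc_eq_empty (by omega)]
  simp [funext_iff]

lemma TS_finite (N r : ℕ) : ∀ s, 1 ≤ s → s + r = N + 1 → ∀ b : ℕ → ℤ,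
    (∀ i ∈ Finset.Icc s N, 0 < b i) → (TS N s b).Finite := by
  induction r with
  | zero =>
    intro s _ h b _
    obtain rfl : s = N + 1 := by omega
    rw [TS_base]
    exact Set.finite_singleton _
  | succ r ih =>
    intro s hs h b hb
    rw [TS_eq N s hs (by omega) b (hb s (by rw [Finset.mem_Icc]; omega))]
    apply Set.Finite.biUnion (Finset.finite_toSet _)
    intro m _
    apply Set.Finite.image
    apply ih _ (by omega) (by omega)
    intro i hi
    rw [Finset.mem_Icc] at hi
    have := hb i (by rw [Finset.mem_Icc]; omega)
    positivity

lemma pr_prod (N s : ℕ) (hsN : s ≤ N) (f : ℕ × ℕ → K) :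
    ∏ p ∈ pr N s, f p = (∏ k ∈ Finset.Icc s N, f (s, k)) * ∏ p ∈ pr N (s + 1), f p := by
  have h : pr N s = ({s} ×ˢ Finset.Icc s N) ∪
      pr N (s + 1) := by
    ext ⟨i, j⟩
    simp only [pr, Finset.mem_filter, Finset.mem_product, Finset.mem_Icc, Finset.mem_union,
      Finset.mem_singleton]
    omega
  rw [h, Finset.prod_union, Finset.prod_product, Finset.prod_singleton]
  · rw [Finset.disjoint_left]
    rintro ⟨i, j⟩
    simp only [pr, Finset.mem_filter, Finset.mem_product, Finset.mem_Icc,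
      Finset.mem_singleton]
    omega

lemma sum_step (w : ℕ → K) (N r s : ℕ) (hs : 1 ≤ s) (h : s + r = N) (b : ℕ → ℤ)
    (hb : ∀ i ∈ Finset.Icc s N, 0 < b i) :
    ∑ᶠ M ∈ TS N s b, ∏ p ∈ pr N s, w (M p) =
      ∑ m ∈ (Finset.Icc s N).finsuppAntidiag (b s).toNat, (∏ k ∈ Finset.Icc s N, w (m k)) *
        ∑ᶠ M ∈ TS N (s + 1) (fun i => b i + (m i : ℤ)), ∏ p ∈ pr N (s + 1), w (M p) := by
  rw [TS_eq N s hs (by omega) b (hb s (by rw [Finset.mem_Icc]; omega)), finsum_mem_biUnion,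
    finsum_mem_coe_finset]
  · apply Finset.sum_congr rfl
    intro m _
    rw [finsum_mem_image, mul_finsum_mem]
    · apply finsum_mem_congr rfl
      intro M _
      rw [pr_prod N s (by omega)]
      congr 1
      · simp [ins]
      · apply Finset.prod_congr rfl
        intro p hp
        simp only [pr, Finset.mem_filter, Finset.mem_product, Finset.mem_Icc] at hp
        rw [ins, if_neg (by omega)]
    · intro M hM M' hM' he
      funext p
      by_cases hp : p.1 = s
      · have hn : p ∉ pr N (s + 1) := by
          simp only [pr, Finset.mem_filter, Finset.mem_product, Finset.mem_Icc]
          omega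
        rw [hM.1 p hn, hM'.1 p hn]
      · have := congrFun he p
        simpa [ins, hp] using this
  · intro m _ m' _ hne
    rw [Function.onFun, Set.disjoint_left]
    rintro _ ⟨M, _, rfl⟩ ⟨M', _, he⟩
    apply hne
    ext k
    have := congrFun he (s, k)
    simpa [ins] using this.symm
  · exact Finset.finite_toSet _
  · intro m _
    apply Set.Finite.image
    apply TS_finite N r _ (by omega) (by omega)
    intro i hi
    rw [Finset.mem_Icc] at hi
    have := hb i (by rw [Finset.mem_Icc]; omega)
    positivity

lemma main_aux (q : K) (hq : q ≠ 0) (h2 : ∀ k : ℕ, k ≠ 0 → q ^ k ≠ 1) (N r : ℕ) :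
    ∀ s, 1 ≤ s → s + r = N + 1 → ∀ b : ℕ → ℤ, (∀ i ∈ Finset.Icc s N, 0 < b i) →
    ∑ᶠ M ∈ TS N s b, ∏ p ∈ pr N s, WW q (M p) =
      (q - 1) ^ (r + 1) / (q ^ (r + 1) - 1) * PP q N s b := by
  induction r with
  | zero =>
    intro s _ h b _
    obtain rfl : s = N + 1 := by omega
    have := sub_ne_zero.2 (h2 1 (by omega))
    rw [pow_one] at this
    rw [TS_base, finsum_mem_singleton, PP, pr, Finset.Icc_eq_empty (by omega)]
    simp [this]
  | succ r ih =>
    intro s hs h b hb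
    rw [sum_step _ N r s hs (by omega) b hb]
    have : ∀ m ∈ (Finset.Icc s N).finsuppAntidiag (b s).toNat,
        (∏ k ∈ Finset.Icc s N, WW q (m k)) *
        ∑ᶠ M ∈ TS N (s + 1) (fun i => b i + (m i : ℤ)), ∏ p ∈ pr N (s + 1), WW q (M p) =
        (q - 1) ^ (r + 1) / (q ^ (r + 1) - 1) *
        ((∏ k ∈ Finset.Icc s N, WW q (m k)) * PP q N (s + 1) (fun i => b i + (m i : ℤ))) := by
      intro m _
      rw [ih (s + 1) (by omega) (by omega)]
      · ring
      · intro i hi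
        rw [Finset.mem_Icc] at hi
        have := hb i (by rw [Finset.mem_Icc]; omega)
        positivity
    rw [Finset.sum_congr rfl this, ← Finset.mul_sum,
      PP_step q hq h2 N s r (by omega) b (hb s (by rw [Finset.mem_Icc]; omega))]
    have h1 := sub_ne_zero.2 (h2 (r + 1) (by omega))
    have h3 := sub_ne_zero.2 (h2 (r + 1 + 1) (by omega))
    field_simp
    ring

end TeslerAux

lemma q_ne : q ≠ 0 := RatFunc.X_ne_zero

lemma q_pow (k : ℕ) (hk : k ≠ 0) : q ^ k ≠ 1 := by
  intro h
  rw [q, ← RatFunc.algebraMap_X, ← map_pow, ← map_one (algebraMap (Polynomial ℚ) (RatFunc ℚ))] at h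
  have := RatFunc.algebraMap_injective ℚ h
  have := congrArg Polynomial.natDegree this
  simp at this
  exact hk this

lemma wt_eq (r : ℕ) : wt r = TeslerAux.WW q r := by
  have hq := q_ne
  have h2 := sub_ne_zero.2 (q_pow 2 (by omega))
  unfold wt TeslerAux.WW TeslerAux.GG
  split_ifs with h
  · subst h; simp
  · simp only [map_add, PowerSeries.coeff_one, h, if_false, PowerSeries.coeff_C_mul, map_sub,
      PowerSeries.coeff_mk, zpow_neg, zpow_natCast, inv_pow]
    field_simp
    ring

theorem tesler_weighted_sum_product_formula (n : ℕ) (hn : 2 ≤ n)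
    (b : ℕ → ℤ) (hb : ∀ i ∈ Finset.Icc 1 (n - 1), 0 < b i)
    (a : ℕ → ℤ) (ha : ∀ k, a k = ∑ l ∈ Finset.Icc 1 k, b l) :
    (∑ᶠ M ∈ {M : ℕ × ℕ → ℕ | IsTesler (n - 1) b M}, ∏ p ∈ upairs (n - 1), wt (M p)) =
      q ^ (-(∑ k ∈ Finset.Icc 1 (n - 1), a k)) * (q - 1) ^ (2 * (n - 1)) *
        qint (q ^ (n : ℤ)) (b 1) *
        ∏ j ∈ Finset.Icc 1 (n - 2), qint q (((j : ℤ) + 1) * a (n - j) - (j : ℤ) * a (n - j - 1)) := by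
  have hq := q_ne
  have hq1 : q - 1 ≠ 0 := by
    have := sub_ne_zero.2 (q_pow 1 (by omega))
    rwa [pow_one] at this
  have main := TeslerAux.main_aux q hq q_pow (n - 1) (n - 1) 1 le_rfl (by omega) b hb
  simp only [← wt_eq] at main
  refine Eq.trans main ?_
  obtain ⟨N, rfl⟩ : ∃ N, n = N + 2 := ⟨n - 2, by omega⟩
  simp only [show N + 2 - 1 = N + 1 by omega, show N + 2 - 2 = N by omega]
  have hrefl : ∏ j ∈ Finset.Icc 1 N,
        qint q (((j : ℤ) + 1) * a (N + 2 - j) - (j : ℤ) * a (N + 2 - j - 1)) =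
      ∏ k ∈ Finset.Icc 2 (N + 1), qint q (a k + (((N + 1 : ℕ) : ℤ) + 1 - k) * b k) := by
    apply Finset.prod_nbij' (fun j => N + 2 - j) (fun j => N + 2 - j)
    · intro j hj; simp only [Finset.mem_Icc] at hj ⊢; omega
    · intro j hj; simp only [Finset.mem_Icc] at hj ⊢; omega
    · intro j hj; simp only [Finset.mem_Icc] at hj ⊢; omega
    · intro j hj; simp only [Finset.mem_Icc] at hj ⊢; omega
    · intro j hj
      simp only [Finset.mem_Icc] at hj
      obtain ⟨k, hk⟩ : ∃ k, N + 2 - j = k + 1 := ⟨N + 1 - j, by omega⟩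
      have hj' : (j : ℤ) = N + 2 - (k + 1) := by omega
      rw [hk, Nat.add_sub_cancel, ha (k + 1), ha k, Finset.sum_Icc_succ_top (by omega), hj']
      congr 1
      push_cast
      ring
  have hPP : TeslerAux.PP q (N + 1) 1 b = q ^ (-(∑ k ∈ Finset.Icc 1 (N + 1), a k)) *
      ∏ k ∈ Finset.Icc 1 (N + 1), (q ^ (a k + (((N + 1 : ℕ) : ℤ) + 1 - k) * b k) - 1) := by
    rw [← Finset.sum_neg_distrib, ← TeslerAux.zpow_sum_aux q hq, ← Finset.prod_mul_distrib]
    apply Finset.prod_congr rfl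
    intro k _
    rw [mul_sub, ← zpow_add₀ hq, ← ha, neg_add_cancel_left, mul_one]
  rw [hrefl, hPP, ← Finset.insert_Icc_add_one_left_eq_Icc (show 1 ≤ N + 1 by omega),
    Finset.prod_insert (by simp)]
  have ha1 : a 1 = b 1 := by rw [ha]; simp
  simp only [qint, Finset.prod_div_distrib, Finset.prod_const, Nat.card_Icc]
  rw [ha1, ← zpow_mul, show b 1 + (((N + 1 : ℕ) : ℤ) + 1 - (1 : ℕ)) * b 1 = ((N + 2 : ℕ) : ℤ) * b 1 by
    push_cast; ring, zpow_natCast, show N + 1 + 1 - 2 = N by omega]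
  have h1 := sub_ne_zero.2 (q_pow (N + 2) (by omega))
  rw [show 1 + 1 = 2 by rfl, show N + 1 + 1 = N + 2 by rfl]
  field_simp
  ring
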